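/- arXiv:1910.06439 — 5 statements merged into one kernel-verified Lean document; each statement's English description precedes it below -/
import Mathlib

section
/- Let p be a prime number, m a nonnegative integer, and N a positive integer. For multi-indices k̲', k̲'' ∈ ℕ^N with k̲ := k̲' + k̲'', the product q_{k̲'}! · q_{k̲''}! divides q_{k̲}!, where q_{k̲}! := q_{k_1}!⋯q_{k_N}!. In particular, the multi-index Berthelot coefficient {k̲ ¦ k̲'} := q_{k̲}!/(q_{k̲'}! · q_{k̲''}!) is a natural number. -/
open Finset in
/-- multi-index version. For a prime `p`, `m : ℕ`, `N > 0` and multi-indices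
`k' k'' : Fin N → ℕ` with `k = k' + k''`, the product `q_{k'}! * q_{k''}!` divides `q_{k}!`,
where `q_{k}! = ∏ i, (k i / p ^ m)!`.  In particular the multi-index Berthelot coefficient
is a natural number. -/
theorem berthelot_factorial_dvd_multiindex (p : ℕ) (hp : p.Prime) (m N : ℕ) (hN : 0 < N)
    (k' k'' : Fin N → ℕ) :
    (∏ i, (k' i / p ^ m).factorial) * (∏ i, (k'' i / p ^ m).factorial) ∣
      ∏ i, ((k' i + k'' i) / p ^ m).factorial := by
  rw [← Finset.prod_mul_distrib]
  refine Finset.prod_dvd_prod_of_dvd _ _ fun i _ => ?_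
  exact (Nat.factorial_mul_factorial_dvd_factorial_add _ _).trans
    (Nat.factorial_dvd_factorial (Nat.add_div_le_add_div _ _ _))
end

section
/- Let p be a prime number, m a nonnegative integer, and k' ≤ k natural numbers with k'' := k − k'. Then the p-adic valuation of Berthelot's coefficient {k ¦ k'} = q_k!/(q_{k'}!·q_{k''}!) is at most the p-adic valuation of the binomial coefficient C(k, k'); equivalently, the modified binomial ⟨k ¦ k'⟩ := C(k,k') · {k ¦ k'}^{-1} is a p-adic integer (an element of ℤ_p). -/
theorem val_fact_step (p : ℕ) [Fact p.Prime] (n : ℕ) :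
    padicValNat p n.factorial = padicValNat p (n / p).factorial + n / p := by
  rw [← padicValNat_mul_div_factorial, padicValNat_factorial_mul]

theorem val_fact_ineq (p : ℕ) [Fact p.Prime] (a b m : ℕ) :
    padicValNat p ((a + b) / p ^ m).factorial + padicValNat p a.factorial
        + padicValNat p b.factorial
      ≤ padicValNat p (a + b).factorial + padicValNat p (a / p ^ m).factorial
        + padicValNat p (b / p ^ m).factorial := by
  induction m with
  | zero => simp
  | succ m ih =>
    rw [val_fact_step p ((a + b) / p ^ m), val_fact_step p (a / p ^ m),
      val_fact_step p (b / p ^ m)] at ih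
    simp only [Nat.div_div_eq_div_mul, ← pow_succ] at ih
    have := @Nat.div_add_div_le_add_div a b (p ^ (m + 1))
    omega


/-- For a prime `p`, `m : ℕ` and `k' ≤ k` with `k'' = k - k'`, the `p`-adic
valuation of Berthelot's coefficient `{k ¦ k'} = q_k! / (q_{k'}! * q_{k''}!)` is at most the
`p`-adic valuation of the binomial coefficient `C(k, k')`; equivalently the modified binomial
`⟨k ¦ k'⟩ = C(k,k') * {k ¦ k'}⁻¹` is a `p`-adic integer. -/
theorem berthelot_modified_binomial_padic_int (p : ℕ) (hp : p.Prime) (m : ℕ)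
    (k k' : ℕ) (h : k' ≤ k) :
    padicValNat p
        ((k / p ^ m).factorial /
          ((k' / p ^ m).factorial * ((k - k') / p ^ m).factorial))
      ≤ padicValNat p (k.choose k') := by
  have := Fact.mk hp
  obtain ⟨b, rfl⟩ := Nat.exists_eq_add_of_le h
  rw [Nat.add_sub_cancel_left]
  have key := val_fact_ineq p k' b m
  have hdvd : (k' / p ^ m).factorial * (b / p ^ m).factorial ∣ ((k' + b) / p ^ m).factorial :=
    (Nat.factorial_mul_factorial_dvd_factorial_add _ _).trans
      (Nat.factorial_dvd_factorial (@Nat.div_add_div_le_add_div k' b (p ^ m)))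
  rw [padicValNat.div_of_dvd hdvd,
    padicValNat.mul (Nat.factorial_ne_zero _) (Nat.factorial_ne_zero _)]
  have hc := congrArg (padicValNat p) (Nat.choose_mul_factorial_mul_factorial h)
  rw [Nat.add_sub_cancel_left] at hc
  have hne : (k' + b).choose k' ≠ 0 := (Nat.choose_pos h).ne'
  rw [padicValNat.mul (mul_ne_zero hne (Nat.factorial_ne_zero _)) (Nat.factorial_ne_zero _),
    padicValNat.mul hne (Nat.factorial_ne_zero _)] at hc
  omega
end

section
/- Let 𝔬 be a commutative ring, A an associative unital 𝔬-algebra, F : ℕ → Submodule 𝔬 A a positive filtration of A (monotone, 1 ∈ F 0, F i · F j ⊆ F (i+j)), and μ ∈ 𝔬. Assume that multiplication by μ is injective on each graded piece of the filtration, i.e. for every d ≥ 1 and a ∈ F d, if μ • a ∈ F (d−1) then a ∈ F (d−1) (this holds in particular when 𝔬 is a discrete valuation ring with uniformizer ϖ, μ = ϖ^k, and the associated graded algebra of (A, F) is flat over 𝔬). Then the filtration on the specialized Rees ring A_μ := ∑_{d ∈ ℕ} μ^d • F d induced from A satisfies, for every d ∈ ℕ: A_μ ∩ F d = ∑_{i=0}^{d}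 μ^i • F i. -/
open Pointwise

/-- With `F` a positive filtration of the `𝔬`-algebra `A` and `μ ∈ 𝔬` such that
multiplication by `μ` is "injective on graded pieces" (for `d ≥ 1` and `a ∈ F d`, if
`μ • a ∈ F (d - 1)` then `a ∈ F (d - 1)`), the filtration induced on the specialized Rees
ring `A_μ = ∑ d, μ ^ d • F d` satisfies `A_μ ⊓ F d = ∑_{i = 0}^{d} μ ^ i • F i` for every
`d : ℕ`. -/
theorem rees_specialization_induced_filtration
    (𝔬 : Type*) [CommRing 𝔬] (A : Type*) [Ring A] [Algebra 𝔬 A]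
    (F : ℕ → Submodule 𝔬 A) (hmono : Monotone F) (hone : (1 : A) ∈ F 0)
    (hmul : ∀ i j : ℕ, ∀ x ∈ F i, ∀ y ∈ F j, x * y ∈ F (i + j)) (μ : 𝔬)
    (hinj : ∀ d : ℕ, 1 ≤ d → ∀ a ∈ F d, μ • a ∈ F (d - 1) → a ∈ F (d - 1)) :
    ∀ d : ℕ, (⨆ i : ℕ, μ ^ i • F i) ⊓ F d = ∑ i ∈ Finset.range (d + 1), μ ^ i • F i := by
  set S : ℕ → Submodule 𝔬 A := fun n => ∑ i ∈ Finset.range (n + 1), μ ^ i • F i with hS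
  have hsucc : ∀ n, S (n + 1) = S n ⊔ μ ^ (n + 1) • F (n + 1) := fun n => by
    simp only [hS]
    rw [Finset.sum_range_succ _ (n + 1), Submodule.add_eq_sup]
  have hSmono : Monotone S := monotone_nat_of_le_succ fun n => by
    rw [hsucc]; exact le_sup_left
  have hle : ∀ n, μ ^ n • F n ≤ S n := fun n => by
    simp only [hS]
    rw [Finset.sum_range_succ, Submodule.add_eq_sup]; exact le_sup_right
  have hsm : ∀ n, μ ^ n • F n ≤ F n := fun n => Submodule.smul_le_self_of_tower _ _
  have hSF : ∀ n, S n ≤ F n := by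
    intro n
    induction n with
    | zero => simp [hS]
    | succ n ih =>
      rw [hsucc]
      exact sup_le (ih.trans (hmono n.le_succ)) (hsm _)
  have hSsup : ∀ n, S n ≤ ⨆ i : ℕ, μ ^ i • F i := by
    intro n
    induction n with
    | zero => simpa [hS] using le_iSup (fun i : ℕ => μ ^ i • F i) 0
    | succ n ih =>
      rw [hsucc]
      exact sup_le ih (le_iSup (fun i : ℕ => μ ^ i • F i) (n + 1))
  have hpow : ∀ k n, ∀ a ∈ F (n + 1), μ ^ k • a ∈ F n → a ∈ F n := by
    intro k n
    induction k with
    | zero => intro a _ h; simpa using h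
    | succ k ih =>
      intro a ha h
      refine ih a ha (hinj (n + 1) (by omega) _ ((F (n + 1)).smul_mem _ ha) ?_)
      rw [pow_succ', mul_smul] at h
      exact h
  have hstep : ∀ n, ∀ x ∈ S (n + 1), x ∈ F n → x ∈ S n := by
    intro n x hx hxF
    rw [hsucc] at hx
    obtain ⟨y, hy, z, hz, rfl⟩ := Submodule.mem_sup.1 hx
    obtain ⟨a, ha, rfl⟩ := (Submodule.mem_smul_pointwise_iff_exists _ _ _).1 hz
    have h1 : μ ^ (n + 1) • a ∈ F n := by
      have := (F n).sub_mem hxF (hSF n hy)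
      simpa using this
    have h2 := hpow _ _ a ha h1
    refine (S n).add_mem hy (hle n ?_)
    rw [pow_succ, mul_smul]
    exact Submodule.smul_mem_pointwise_smul _ _ _ ((F n).smul_mem _ h2)
  have hdown : ∀ d k, ∀ x ∈ S (d + k), x ∈ F d → x ∈ S d := by
    intro d k
    induction k with
    | zero => intro x hx _; exact hx
    | succ k ih =>
      intro x hx hxF
      exact ih x (hstep (d + k) x hx (hmono (Nat.le_add_right d k) hxF)) hxF
  intro d
  change _ = S d
  apply le_antisymm
  · rintro x ⟨hx, hxF⟩
    have hx' : x ∈ ⨆ n, S n := iSup_mono hle hx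
    obtain ⟨n, hn⟩ := (Submodule.mem_iSup_of_directed S hSmono.directed_le).1 hx'
    exact hdown d n x (hSmono (Nat.le_add_left n d) hn) hxF
  · exact le_inf (hSsup d) (hSF d)
end

section
/- Let p be a prime number, m a nonnegative integer, R a commutative ring, and define the level-m divided derivative ∂^⟨n⟩ := q_n! • hasseDeriv n on the polynomial ring R[X]. Then for all polynomials f, g ∈ R[X] and every n ∈ ℕ, the twisted Leibniz formula holds: ∂^⟨n⟩(f·g) = ∑_{i=0}^{n} {n ¦ i} • (∂^⟨i⟩ f) · (∂^⟨n−i⟩ g); explicitly, q_n! • hasseDeriv n (f·g) = ∑_{i+j=n} {n ¦ i} • (q_i! • hasseDeriv i f) · (q_j! • hasseDeriv j g), where {n ¦ i} = q_n!/(q_i!·q_{n−i}!) is Berthelot's (natural number) coefficient. -/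
open Polynomial

/-- twisted Leibniz formula for the level-`m` divided derivatives
`∂^⟨n⟩ = q_n ! • hasseDeriv n` (where `q_n = n / p ^ m`):
`∂^⟨n⟩ (f * g) = ∑_{i = 0}^{n} {n ¦ i} • (∂^⟨i⟩ f) * (∂^⟨n - i⟩ g)`,
where `{n ¦ i} = q_n ! / (q_i ! * q_{n - i} !)` is Berthelot's coefficient. -/
theorem level_m_divided_derivative_leibniz (p : ℕ) (hp : p.Prime) (m : ℕ)
    (R : Type*) [CommRing R] (f g : R[X]) (n : ℕ) :
    (n / p ^ m).factorial • hasseDeriv n (f * g) =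
      ∑ i ∈ Finset.range (n + 1),
        ((n / p ^ m).factorial /
            ((i / p ^ m).factorial * ((n - i) / p ^ m).factorial)) •
          (((i / p ^ m).factorial • hasseDeriv i f) *
            (((n - i) / p ^ m).factorial • hasseDeriv (n - i) g)) := by
  rw [hasseDeriv_mul,
    Finset.Nat.sum_antidiagonal_eq_sum_range_succ
      (fun i j => hasseDeriv i f * hasseDeriv j g) n, Finset.smul_sum]
  refine Finset.sum_congr rfl fun i hi => ?_
  have hin : i ≤ n := Nat.lt_succ_iff.mp (Finset.mem_range.mp hi)
  have hle : i / p ^ m + (n - i) / p ^ m ≤ n / p ^ m := by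
    have h := Nat.add_div_le_add_div i (n - i) (p ^ m)
    rwa [Nat.add_sub_cancel' hin] at h
  have hdvd : (i / p ^ m).factorial * ((n - i) / p ^ m).factorial ∣ (n / p ^ m).factorial :=
    (Nat.factorial_mul_factorial_dvd_factorial_add _ _).trans (Nat.factorial_dvd_factorial hle)
  rw [smul_mul_smul_comm, smul_smul, Nat.div_mul_cancel hdvd]
end

section
/- Let p be a prime number and e, k positive integers with e ≤ k(p − 1). Then for every integer n ≥ 1, one has e · padicValNat p (n!) ≤ (n − 1)·k. (This is the valuation estimate showing that in a discrete valuation ring of mixed characteristic (0,p) with absolute ramification index e, the operations γ_n(x) = x^n/n! map the ideal (ϖ)^k into itself whenever e ≤ k(p−1).) -/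
/-- Let `p` be prime and `e, k` positive integers with `e ≤ k * (p - 1)`.
Then for every `n ≥ 1` one has `e * v_p(n!) ≤ (n - 1) * k`. -/
theorem ramification_factorial_valuation_bound (p : ℕ) (hp : p.Prime)
    (e k : ℕ) (he : 0 < e) (hk : 0 < k) (h : e ≤ k * (p - 1)) :
    ∀ n : ℕ, 1 ≤ n → e * padicValNat p n.factorial ≤ (n - 1) * k := by
  intro n hn
  haveI : Fact p.Prime := ⟨hp⟩
  have h1 : (p - 1) * padicValNat p n.factorial < n :=
    sub_one_mul_padicValNat_factorial_lt_of_ne_zero p (by omega)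
  calc e * padicValNat p n.factorial
      ≤ k * (p - 1) * padicValNat p n.factorial := Nat.mul_le_mul_right _ h
    _ = ((p - 1) * padicValNat p n.factorial) * k := by ring
    _ ≤ (n - 1) * k := Nat.mul_le_mul_right _ (by omega)
end
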